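/- For every 0 ≤ i ≤ δ − 2σ, one has B_{σ+i} = x_n^i·B_σ. -/

import Mathlib

open MvPolynomial

/-- The total degree of an exponent vector. -/
def expDeg {n : ℕ} (μ : Fin n →₀ ℕ) : ℕ := μ.sum fun _ e => e

/-- Strict degree reverse lexicographic order on exponent vectors, for variables
`x_1 > ⋯ > x_n` (indexed by `Fin n` in this order). -/
def DrlLT {n : ℕ} (a b : Fin n →₀ ℕ) : Prop :=
  expDeg a < expDeg b ∨
    (expDeg a = expDeg b ∧ ∃ i : Fin n, b i < a i ∧ ∀ j : Fin n, i < j → a j = b j)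

/-- `μ` is the leading (degrevlex-largest) exponent of `p`. -/
def IsLeadExp {n : ℕ} {K : Type*} [CommSemiring K] (p : MvPolynomial (Fin n) K)
    (μ : Fin n →₀ ℕ) : Prop :=
  μ ∈ p.support ∧ ∀ ν ∈ p.support, ν ≠ μ → DrlLT ν μ

/-- The initial ideal of `I` with respect to the degree reverse lexicographic order. -/
noncomputable def initialIdeal {n : ℕ} {K : Type*} [CommRing K]
    (I : Ideal (MvPolynomial (Fin n) K)) : Ideal (MvPolynomial (Fin n) K) :=
  Ideal.span { m | ∃ p ∈ I, p ≠ 0 ∧ ∃ μ, IsLeadExp p μ ∧ m = monomial μ (1 : K) }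

/-- The standard monomials of degree `i` of `I` : exponents of the monomials of degree `i`
not lying in the initial ideal of `I`. -/
def stdMon {n : ℕ} {K : Type*} [CommRing K] (I : Ideal (MvPolynomial (Fin n) K)) (i : ℕ) :
    Set (Fin n →₀ ℕ) :=
  { μ | expDeg μ = i ∧ monomial μ (1 : K) ∉ initialIdeal I }

/-- `μ` is a minimal monomial generator of the monomial ideal `M`. -/
def IsMinGen {n : ℕ} {K : Type*} [CommRing K] (M : Ideal (MvPolynomial (Fin n) K))
    (μ : Fin n →₀ ℕ) : Prop :=
  monomial μ (1 : K) ∈ M ∧ ∀ ν : Fin n →₀ ℕ, ν ≤ μ → ν ≠ μ → monomial ν (1 : K) ∉ M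

/-- `μ` satisfies property `P` with respect to the monomial ideal `M`: if `m` is the largest
index of a variable dividing `x^μ`, then every monomial of the same degree in the variables of
index `< m` also lies in `M`. -/
def SatisfiesP {n : ℕ} {K : Type*} [CommRing K] (M : Ideal (MvPolynomial (Fin n) K))
    (μ : Fin n →₀ ℕ) : Prop :=
  ∀ m : Fin n, μ m ≠ 0 → (∀ j : Fin n, m < j → μ j = 0) →
    ∀ ν : Fin n →₀ ℕ, expDeg ν = expDeg μ → (∀ j : Fin n, m ≤ j → ν j = 0) →
      monomial ν (1 : K) ∈ M

/-- Conjecture E (Pardue) holds for the ideal `I`: every minimal generator of the initial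
ideal of `I` satisfies property `P`. -/
def ConjE {n : ℕ} {K : Type*} [CommRing K] (I : Ideal (MvPolynomial (Fin n) K)) : Prop :=
  ∀ μ, IsMinGen (initialIdeal I) μ → SatisfiesP (initialIdeal I) μ

/-- `f` is a generic sequence of forms of degrees `d i` over the base field `F`: each `f i` is
homogeneous of degree `d i` and the family of all coefficients (at all monomials of degree
`d i`) is algebraically independent over `F`. -/
def IsGenericSeq (F : Type*) {K : Type*} [CommRing F] [CommRing K] [Algebra F K]
    {n r : ℕ} (d : Fin r → ℕ) (f : Fin r → MvPolynomial (Fin n) K) : Prop :=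
  (∀ i, (f i).IsHomogeneous (d i)) ∧
    AlgebraicIndependent F
      (fun p : Σ i : Fin r, { μ : Fin n →₀ ℕ // expDeg μ = d i } => (f p.1).coeff p.2.1)

/-- The projection `K[x_1,…,x_n,z] → K[x_1,…,x_n]` sending `z` (the last variable) to `0` and
fixing the other variables. -/
noncomputable def projMap (K : Type*) [CommRing K] (n : ℕ) :
    MvPolynomial (Fin (n + 1)) K →ₐ[K] MvPolynomial (Fin n) K :=
  aeval (fun i => Fin.lastCases 0 (fun j => X j) i)

/-- Embedding of exponent vectors of `K[x_1,…,x_n]` into those of `K[x_1,…,x_n,z]`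
(`z`-exponent `0`). -/
noncomputable def embExp {n : ℕ} (μ : Fin n →₀ ℕ) : Fin (n + 1) →₀ ℕ :=
  Finsupp.embDomain ⟨Fin.castSucc, Fin.castSucc_injective n⟩ μ

/-- Multiplication by `z^c` on exponent vectors in `K[x_1,…,x_n,z]`. -/
noncomputable def zShift {n : ℕ} (c : ℕ) (μ : Fin (n + 1) →₀ ℕ) : Fin (n + 1) →₀ ℕ :=
  μ + Finsupp.single (Fin.last n) c

/-- `f` (homogeneous of degree `e`) is semi-regular on `R/I`: in each degree `t`, the
multiplication map `(R/I)_t → (R/I)_{t+e}` is injective or surjective. -/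
def SemiRegularOn {vars K : Type*} [CommRing K] (I : Ideal (MvPolynomial vars K))
    (f : MvPolynomial vars K) (e : ℕ) : Prop :=
  ∀ t : ℕ,
    (∀ p ∈ homogeneousSubmodule vars K t, f * p ∈ I → p ∈ I) ∨
    (∀ q ∈ homogeneousSubmodule vars K (t + e),
      ∃ p ∈ homogeneousSubmodule vars K t, q - f * p ∈ I)

/-- The degree-`t` graded piece of `R/I`, as a `K`-submodule of the quotient. -/
noncomputable def quotDegPart {vars K : Type*} [CommRing K] (I : Ideal (MvPolynomial vars K))
    (t : ℕ) : Submodule K (MvPolynomial vars K ⧸ I) :=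
  (homogeneousSubmodule vars K t).map (Ideal.Quotient.mkₐ K I).toLinearMap

/-- Interpolation at the nodes `1, q, …, q ^ (card U - 1)` by the monomials `X ^ u`, `u ∈ U`. -/
theorem exists_dvd_X_pow_sub_sum {L : Type*} [Field L] {q : L}
    (hq : Function.Injective fun k : ℕ => q ^ k) (U : Finset ℕ) (a : ℕ) :
    ∃ w : ℕ → L, (∏ r ∈ Finset.range U.card, (Polynomial.X - Polynomial.C (q ^ r))) ∣
      Polynomial.X ^ a - ∑ u ∈ U, w u • Polynomial.X ^ u := by
  classical
  let e : Fin U.card ≃ U := U.equivFin.symm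
  let V : Matrix (Fin U.card) (Fin U.card) L := Matrix.vandermonde fun i => q ^ (e i : ℕ)
  have hV : IsUnit V.det := by
    rw [isUnit_iff_ne_zero, Matrix.det_vandermonde_ne_zero_iff]
    intro i j hij
    exact e.injective (Subtype.ext (hq hij))
  obtain ⟨w, hw⟩ : ∃ w, Matrix.vecMul w V = fun r : Fin U.card => (q ^ (r : ℕ)) ^ a :=
    ⟨Matrix.vecMul (fun r : Fin U.card => (q ^ (r : ℕ)) ^ a) V⁻¹, by
      rw [Matrix.vecMul_vecMul, Matrix.nonsing_inv_mul _ hV, Matrix.vecMul_one]⟩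
  refine ⟨fun u => if h : u ∈ U then w (e.symm ⟨u, h⟩) else 0, ?_⟩
  refine Finset.prod_dvd_of_coprime ?_ ?_
  · intro r _ s _ hrs
    refine Polynomial.isCoprime_X_sub_C_of_isUnit_sub ?_
    rw [isUnit_iff_ne_zero, sub_ne_zero]
    exact fun h => hrs (hq h)
  · intro r hr
    rw [Polynomial.dvd_iff_isRoot, Polynomial.IsRoot.def]
    have h := congrFun hw ⟨r, Finset.mem_range.mp hr⟩
    simp only [Matrix.vecMul, dotProduct, V, Matrix.vandermonde_apply] at h
    rw [← e.symm.sum_comp] at h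
    rw [← Finset.sum_attach]
    simp only [Polynomial.eval_sub, Polynomial.eval_pow, Polynomial.eval_X,
      Polynomial.eval_finsetSum, Polynomial.eval_smul, smul_eq_mul]
    rw [sub_eq_zero, ← h, ← Finset.univ_eq_attach]
    refine Finset.sum_congr rfl fun u _ => ?_
    simp only [Equiv.apply_symm_apply, u.2, dif_pos, Subtype.coe_eta]
    rw [← pow_mul, ← pow_mul, mul_comm (u : ℕ)]

/-- The homogeneous version of `exists_dvd_X_pow_sub_sum`, evaluated in an algebra. -/
theorem exists_dvd_mul_sub_sum {L R : Type*} [Field L] [CommRing R] [Algebra L R] {q : L}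
    (hq : Function.Injective fun k : ℕ => q ^ k) (y l : R) {t a : ℕ} (ha : a ≤ t)
    (U : Finset ℕ) (hU : ∀ u ∈ U, u ≤ t) :
    ∃ w : ℕ → L, (∏ r ∈ Finset.range U.card, (y - q ^ r • l)) ∣
      y ^ a * l ^ (t - a) - ∑ u ∈ U, w u • (y ^ u * l ^ (t - u)) := by
  obtain ⟨w, g, hg⟩ := exists_dvd_X_pow_sub_sum hq U a
  refine ⟨w, ?_⟩
  set P : Polynomial L := ∏ r ∈ Finset.range U.card, (Polynomial.X - Polynomial.C (q ^ r)) with hP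
  have hPm : P.Monic := Polynomial.monic_prod_of_monic _ _ fun r _ => Polynomial.monic_X_sub_C _
  have hPd : P.natDegree = U.card := by
    rw [hP, Polynomial.natDegree_prod_of_monic _ _ fun r _ => Polynomial.monic_X_sub_C _]
    simp only [Polynomial.natDegree_X_sub_C, Finset.sum_const, Finset.card_range, smul_eq_mul,
      mul_one]
  have hPh : MvPolynomial.aeval ![y, l] (P.homogenize U.card) =
      ∏ r ∈ Finset.range U.card, (y - q ^ r • l) := by
    have h := Polynomial.homogenize_finsetProd (s := Finset.range U.card)
      (p := fun r => Polynomial.X - Polynomial.C (q ^ r)) (n := fun _ => 1)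
      (fun r _ => (Polynomial.natDegree_X_sub_C _).le)
    simp only [Finset.sum_const, Finset.card_range, smul_eq_mul, mul_one] at h
    rw [hP, h, map_prod]
    refine Finset.prod_congr rfl fun r _ => ?_
    rw [Polynomial.homogenize_sub, Polynomial.homogenize_X one_ne_zero, Polynomial.homogenize_C]
    simp [Algebra.smul_def]
  have hev := congrArg (fun p => MvPolynomial.aeval ![y, l] (Polynomial.homogenize p t)) hg
  simp only [Polynomial.homogenize_sub, Polynomial.homogenize_finsetSum, map_sub, map_sum,
    Polynomial.homogenize_smul, Polynomial.homogenize_X_pow ha, map_smul, map_mul, map_pow,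
    aeval_X] at hev
  have hs : ∑ u ∈ U, w u • aeval ![y, l] (Polynomial.homogenize (Polynomial.X ^ u : Polynomial L) t)
      = ∑ u ∈ U, w u • (y ^ u * l ^ (t - u)) := by
    refine Finset.sum_congr rfl fun u hu => ?_
    rw [Polynomial.homogenize_X_pow (hU u hu)]
    simp
  rw [hs] at hev
  simp only [Matrix.cons_val_zero, Matrix.cons_val_one] at hev
  rw [hev]
  by_cases hg0 : g = 0
  · simp [hg0]
  have hdeg : (P * g).natDegree ≤ t := by
    rw [← hg]
    refine (Polynomial.natDegree_sub_le_of_le (n := t) (m := t) (by simpa using ha) ?_).trans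
      (max_self t).le
    refine Polynomial.natDegree_sum_le_of_forall_le _ _ fun u hu => ?_
    exact (Polynomial.natDegree_smul_le _ _).trans (by simpa using hU u hu)
  rw [hPm.natDegree_mul' hg0, hPd] at hdeg
  obtain ⟨m, rfl⟩ : ∃ m, t = U.card + m := ⟨t - U.card, by omega⟩
  rw [Polynomial.homogenize_mul P g hPd.le (by omega : g.natDegree ≤ m), map_mul, hPh]
  exact dvd_mul_right _ _

/-- The graded pieces `⨁ y ^ v V (N - v)` obtained from the pieces `V` by adjoining `y`. -/
def adjoinPieces {L R : Type*} [Field L] [CommRing R] [Algebra L R] (V : ℤ → Submodule L R)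
    (y : R) (N : ℤ) : Submodule L R :=
  ⨆ v : ℕ, (V (N - v)).map (LinearMap.mulLeft L (y ^ v))

theorem mul_mem_adjoinPieces {L R : Type*} [Field L] [CommRing R] [Algebra L R]
    {V : ℤ → Submodule L R} {b : R} {u : ℤ} (hb : b ∈ V u) (y : R) (v : ℕ) {N : ℤ}
    (hN : N = u + v) : y ^ v * b ∈ adjoinPieces V y N := by
  refine Submodule.mem_iSup_of_mem v ⟨b, ?_, rfl⟩
  rwa [hN, add_sub_cancel_right]

/-- Modulo `I`, every element of `V N` is a multiple of `l ^ s` whenever `δ + s ≤ 2 N`: the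
surjectivity half of the strong Lefschetz property with socle degree `δ`. -/
def LefschetzSurj {L R : Type*} [Field L] [CommRing R] [Algebra L R] (V : ℤ → Submodule L R)
    (l : R) (δ : ℤ) (I : Ideal R) : Prop :=
  ∀ (N : ℤ) (s : ℕ), δ + s ≤ 2 * N → ∀ b ∈ V N, ∃ c ∈ V (N - s), b - l ^ s * c ∈ I

theorem pow_mul_mem_pieces {L R : Type*} [Field L] [CommRing R] [Algebra L R]
    {V : ℤ → Submodule L R} {l : R} (hl : ∀ N, ∀ b ∈ V N, l * b ∈ V (N + 1)) (i : ℕ) :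
    ∀ N, ∀ b ∈ V N, l ^ i * b ∈ V (N + i) := by
  induction i with
  | zero => simp
  | succ i ih =>
    intro N b hb
    have := hl _ _ (ih N b hb)
    rwa [← mul_assoc, ← pow_succ', add_assoc, ← Nat.cast_succ] at this

/-- Lefschetz decomposition: the primitive elements generate. -/
theorem LefschetzSurj.induction {L R : Type*} [Field L] [CommRing R] [Algebra L R]
    {V : ℤ → Submodule L R} {l : R} {δ : ℤ} {I : Ideal R} (h : LefschetzSurj V l δ I)
    (hneg : ∀ N < 0, V N = ⊥) (hl : ∀ N, ∀ b ∈ V N, l * b ∈ V (N + 1))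
    {T : ℤ → Submodule L R} (hI : ∀ N, I.restrictScalars L ≤ T N)
    (hT : ∀ (e : ℤ) (k i : ℕ), (k : ℤ) = δ - 2 * e + 1 → 2 * e ≤ δ → ∀ p ∈ V e,
      l ^ k * p ∈ I → l ^ i * p ∈ T (e + i)) :
    ∀ N, ∀ b ∈ V N, b ∈ T N := by
  have low : ∀ (m : ℕ) (e : ℤ), e < m → 2 * e ≤ δ → ∀ b ∈ V e, ∀ i : ℕ,
      l ^ i * b ∈ T (e + i) := by
    intro m
    induction m with
    | zero =>
      intro e he _ b hb i
      rw [hneg e (by simpa using he), Submodule.mem_bot] at hb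
      simp [hb]
    | succ m ih =>
      intro e he hδ b hb i
      obtain ⟨k, hk⟩ : ∃ k : ℕ, (k : ℤ) = δ - 2 * e + 1 := ⟨(δ - 2 * e + 1).toNat, by omega⟩
      obtain ⟨c, hc, hcI⟩ := h (e + k) (k + 1) (by push_cast; omega) _
        (pow_mul_mem_pieces hl k e b hb)
      rw [show e + k - ((k + 1 : ℕ) : ℤ) = e - 1 by push_cast; ring] at hc
      have hlc : l * c ∈ V e := by simpa using hl _ _ hc
      have h1 : l ^ i * (b - l * c) ∈ T (e + i) :=
        hT e k i hk hδ _ (sub_mem hb hlc) (by convert hcI using 1; ring)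
      have h2 := ih (e - 1) (by push_cast at he; omega) (by omega) c hc (i + 1)
      rw [show e - 1 + ((i + 1 : ℕ) : ℤ) = e + i by push_cast; ring] at h2
      convert add_mem h1 h2 using 1
      ring
  intro N b hb
  by_cases hN : 2 * N ≤ δ
  · simpa using low (N + 1).toNat N (by omega) hN b hb 0
  · obtain ⟨s, hs⟩ : ∃ s : ℕ, (s : ℤ) = 2 * N - δ := ⟨(2 * N - δ).toNat, by omega⟩
    obtain ⟨c, hc, hcI⟩ := h N s (by omega) b hb
    have h1 := low (N - s + 1).toNat (N - s) (by omega) (by omega) c hc s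
    rw [sub_add_cancel] at h1
    simpa using add_mem (hI N hcI) h1

/-- If `V` has the Lefschetz property with respect to `l`, then adjoining `y` subject to a
product of `d` distinct linear forms in `y` and `l` gives the Lefschetz property with respect
to `y`. -/
theorem LefschetzSurj.adjoin {L R : Type*} [Field L] [CommRing R] [Algebra L R]
    {V : ℤ → Submodule L R} {l : R} {δ : ℤ} {I : Ideal R} (h : LefschetzSurj V l δ I)
    (hneg : ∀ N < 0, V N = ⊥) (hl : ∀ N, ∀ b ∈ V N, l * b ∈ V (N + 1)) {q : L}
    (hq : Function.Injective fun k : ℕ => q ^ k) (y : R) (d : ℕ) {I' : Ideal R} (hII' : I ≤ I')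
    (hI' : ∏ r ∈ Finset.range d, (y - q ^ r • l) ∈ I') :
    LefschetzSurj (adjoinPieces V y) y (δ + d - 1) I' := by
  intro N s hN
  let T : Submodule L R :=
    I'.restrictScalars L ⊔ (adjoinPieces V y (N - s)).map (LinearMap.mulLeft L (y ^ s))
  have hTI : ∀ b ∈ I', b ∈ T := fun b hb => Submodule.mem_sup_left hb
  have hTs : ∀ b ∈ adjoinPieces V y (N - s), y ^ s * b ∈ T := fun b hb =>
    Submodule.mem_sup_right ⟨b, hb, rfl⟩
  suffices H : adjoinPieces V y N ≤ T by
    intro b hb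
    obtain ⟨z, hz, w, ⟨c, hc, rfl⟩, hzw⟩ := Submodule.mem_sup.mp (H hb)
    exact ⟨c, hc, by simpa [← hzw] using hz⟩
  let S : ℤ → Submodule L R := fun u =>
    ⨅ (v : ℕ) (_ : N = u + v), T.comap (LinearMap.mulLeft L (y ^ v))
  have H : ∀ u, ∀ b ∈ V u, b ∈ S u := by
    refine h.induction hneg hl ?_ ?_
    · intro u x hx
      simp only [S, Submodule.mem_iInf]
      exact fun v _ => hTI _ (I'.mul_mem_left _ (hII' hx))
    · intro e k i hk he p hp hkp
      simp only [S, Submodule.mem_iInf, Submodule.mem_comap, LinearMap.mulLeft_apply]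
      intro v hv
      set t := i + v with ht
      have hbig : ∀ u, k ≤ u → ∀ v, y ^ v * (l ^ u * p) ∈ T := by
        intro u hu v
        obtain ⟨m, rfl⟩ := Nat.exists_eq_add_of_le hu
        refine hTI _ (hII' ?_)
        rw [pow_add, show y ^ v * (l ^ k * l ^ m * p) = y ^ v * l ^ m * (l ^ k * p) by ring]
        exact I.mul_mem_left _ hkp
      have hsml : ∀ u v, u + v = t → s ≤ v → y ^ v * (l ^ u * p) ∈ T := by
        intro u v huv hsv
        obtain ⟨m, rfl⟩ := Nat.exists_eq_add_of_le hsv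
        rw [pow_add, mul_assoc]
        exact hTs _ (mul_mem_adjoinPieces (pow_mul_mem_pieces hl u e p hp) y m (by omega))
      by_cases hks : k + s ≤ t + 1
      · by_cases hki : k ≤ i
        · exact hbig i hki v
        · exact hsml i v rfl (by omega)
      · have hcard : d ≤ ((Finset.Icc s t) ∪ (Finset.range (t + 1 - k))).card := by
          rw [Finset.card_union_of_disjoint]
          · simp only [Nat.card_Icc, Finset.card_range]
            omega
          · rw [Finset.disjoint_left]
            intro u hu hu'
            simp only [Finset.mem_Icc, Finset.mem_range] at hu hu'
            omega
        obtain ⟨U, hU, rfl⟩ := Finset.exists_subset_card_eq hcard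
        have hU' : ∀ u ∈ U, (s ≤ u ∧ u ≤ t) ∨ u + k ≤ t := by
          intro u hu
          have := hU hu
          simp only [Finset.mem_union, Finset.mem_Icc, Finset.mem_range] at this
          omega
        obtain ⟨w, g, hg⟩ := exists_dvd_mul_sub_sum hq y l (show v ≤ t by omega) U
          (fun u hu => by have := hU' u hu; omega)
        have hti : t - v = i := by omega
        have : y ^ v * (l ^ i * p) = ((∏ r ∈ Finset.range U.card, (y - q ^ r • l)) * g) * p +
            ∑ u ∈ U, w u • (y ^ u * (l ^ (t - u) * p)) := by
          rw [← hg, hti, sub_mul, Finset.sum_mul]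
          simp only [smul_mul_assoc, mul_assoc]
          ring
        rw [this]
        refine add_mem (hTI _ (I'.mul_mem_right _ (I'.mul_mem_right _ hI'))) (sum_mem fun u hu => ?_)
        refine T.smul_mem _ ?_
        rcases hU' u hu with hu | hu
        · exact hsml _ _ (by omega) hu.1
        · exact hbig _ (by omega) _
  refine iSup_le fun v => Submodule.map_le_iff_le_comap.mpr fun b hb => ?_
  have hb' := H _ b hb
  simp only [S, Submodule.mem_iInf, Submodule.mem_comap] at hb'
  exact hb' v (by ring)

/-- The graded pieces of the polynomials in `x 0, …, x (m - 1)`. -/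
def pieces (L : Type*) {R : Type*} [Field L] [CommRing R] [Algebra L R] (x : ℕ → R) :
    ℕ → ℤ → Submodule L R
  | 0 => fun N => if N = 0 then Submodule.span L {1} else ⊥
  | m + 1 => adjoinPieces (pieces L x m) (x m)

theorem pieces_eq_bot {L R : Type*} [Field L] [CommRing R] [Algebra L R] (x : ℕ → R) (m : ℕ) :
    ∀ N < 0, pieces L x m N = ⊥ := by
  induction m with
  | zero => exact fun N hN => if_neg hN.ne
  | succ m ih =>
    intro N hN
    simp only [pieces, adjoinPieces]
    refine iSup_eq_bot.mpr fun v => ?_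
    rw [ih _ (by omega), Submodule.map_bot]

theorem mul_mem_pieces_succ {L R : Type*} [Field L] [CommRing R] [Algebra L R] (x : ℕ → R)
    (m : ℕ) (N : ℤ) : ∀ b ∈ pieces L x (m + 1) N, x m * b ∈ pieces L x (m + 1) (N + 1) := by
  suffices H : pieces L x (m + 1) N ≤
      (pieces L x (m + 1) (N + 1)).comap (LinearMap.mulLeft L (x m)) from fun b hb => H hb
  refine iSup_le fun v => Submodule.map_le_iff_le_comap.mpr fun b hb => ?_
  simp only [Submodule.mem_comap, LinearMap.mulLeft_apply]
  rw [← mul_assoc, ← pow_succ']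
  exact mul_mem_adjoinPieces hb _ _ (by push_cast; ring)

/-- The variable preceding `x m`, or `0` if `m = 0`. -/
def prevVar {R : Type*} [CommRing R] (x : ℕ → R) : ℕ → R
  | 0 => 0
  | m + 1 => x m

/-- An iterated complete intersection of products of linear forms in two consecutive variables
has the strong Lefschetz property with respect to the last variable. -/
theorem lefschetzSurj_pieces {L R : Type*} [Field L] [CommRing R] [Algebra L R] (x : ℕ → R)
    {q : L} (hq : Function.Injective fun k : ℕ => q ^ k) (d : ℕ → ℕ) (m : ℕ) (I : Ideal R)
    (hI : ∀ j < m, ∏ r ∈ Finset.range (d j), (x j - q ^ r • prevVar x j) ∈ I) :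
    LefschetzSurj (pieces L x m) (prevVar x m) (∑ j ∈ Finset.range m, ((d j : ℤ) - 1)) I := by
  induction m with
  | zero =>
    intro N s hN b hb
    simp only [Finset.range_zero, Finset.sum_empty, zero_add] at hN
    by_cases h0 : N = 0
    · obtain rfl : s = 0 := by omega
      exact ⟨b, by simpa using hb, by simp⟩
    · simp only [pieces, h0, if_false, Submodule.mem_bot] at hb
      exact ⟨0, zero_mem _, by simp [hb]⟩
  | succ m ih =>
    rw [Finset.sum_range_succ, ← add_sub_assoc]
    refine (ih fun j hj => hI j (by omega)).adjoin (pieces_eq_bot x m) ?_ hq (x m) (d m) le_rfl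
      (hI m (by omega))
    intro N b hb
    cases m with
    | zero => simp [prevVar]
    | succ m => exact mul_mem_pieces_succ x m N b hb

/-- Spanning is an open condition: a family of vectors with polynomial entries spanning at one
point spans at an algebraically independent point. -/
theorem span_eq_top_of_algebraicIndependent {F K ι E κ : Type*} [Field F] [Field K] [Algebra F K]
    [Finite E] (M : κ → E → MvPolynomial ι F) {c : ι → K} (hc : AlgebraicIndependent F c)
    (c₀ : ι → K)
    (h₀ : Submodule.span K (Set.range fun k e => aeval c₀ (M k e)) = ⊤) :
    Submodule.span K (Set.range fun k e => aeval c (M k e)) = ⊤ := by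
  classical
  have := Fintype.ofFinite E
  obtain ⟨κ', a, -, hspan, hli⟩ :=
    exists_linearIndependent' K (fun k e => aeval c₀ (M k e))
  rw [h₀] at hspan
  let b := Module.Basis.mk hli hspan.ge
  let g : E ≃ κ' := (Pi.basisFun K E).indexEquiv b
  let P : Matrix E E (MvPolynomial ι F) := Matrix.of fun i e => M (a (g i)) e
  have hdet₀ : aeval c₀ P.det ≠ 0 := by
    rw [AlgHom.map_det, ← isUnit_iff_ne_zero, ← Matrix.isUnit_iff_isUnit_det,
      ← Matrix.linearIndependent_rows_iff_isUnit]
    exact hli.comp g g.injective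
  have hdet : aeval c P.det ≠ 0 := fun h =>
    hdet₀ (by rw [(injective_iff_map_eq_zero _).mp hc _ h, map_zero])
  rw [AlgHom.map_det, ← isUnit_iff_ne_zero, ← Matrix.isUnit_iff_isUnit_det,
    ← Matrix.linearIndependent_rows_iff_isUnit] at hdet
  rw [eq_top_iff, ← hdet.span_eq_top_of_card_eq_finrank' (by simp)]
  refine Submodule.span_mono ?_
  rintro _ ⟨i, rfl⟩
  exact ⟨a (g i), rfl⟩

theorem expDeg_eq_degree {n : ℕ} (μ : Fin n →₀ ℕ) : expDeg μ = μ.degree := rfl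

theorem expDeg_add {n : ℕ} (μ ν : Fin n →₀ ℕ) : expDeg (μ + ν) = expDeg μ + expDeg ν := by
  simp only [expDeg_eq_degree, map_add]

theorem expDeg_single {n : ℕ} (j : Fin n) (k : ℕ) : expDeg (Finsupp.single j k) = k := by
  simp [expDeg_eq_degree]

theorem expDeg_eq_sum {n : ℕ} (μ : Fin n →₀ ℕ) : expDeg μ = ∑ j, μ j := by
  rw [expDeg_eq_degree, Finsupp.degree_eq_sum]

theorem isHomogeneous_monomial_expDeg {n : ℕ} {K : Type*} [CommSemiring K] (μ : Fin n →₀ ℕ)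
    (a : K) : (monomial μ a).IsHomogeneous (expDeg μ) :=
  isHomogeneous_monomial a rfl

/-- The monomials of degree `N` in `G` together with the degree-`N` monomial multiples of the
forms `f j` of degrees `d j`. -/
noncomputable def multiplesFamily {n r : ℕ} {K : Type*} [Field K] (d : Fin r → ℕ)
    (f : Fin r → MvPolynomial (Fin n) K) (N : ℕ) (G : Set (Fin n →₀ ℕ)) :
    ({a : Fin n →₀ ℕ // expDeg a = N ∧ a ∈ G} ⊕
      (Σ j : Fin r, {ν : Fin n →₀ ℕ // expDeg ν + d j = N})) → MvPolynomial (Fin n) K :=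
  Sum.elim (fun a => monomial a.1 1) fun p => monomial p.2.1 1 * f p.1

/-- The span of `multiplesFamily d f N G`. -/
noncomputable def multiplesSpan {n r : ℕ} {K : Type*} [Field K] (d : Fin r → ℕ)
    (f : Fin r → MvPolynomial (Fin n) K) (N : ℕ) (G : Set (Fin n →₀ ℕ)) :
    Submodule K (MvPolynomial (Fin n) K) :=
  Submodule.span K (Set.range (multiplesFamily d f N G))

section multiplesSpan

variable {n r : ℕ} {K : Type*} [Field K] {d : Fin r → ℕ} {f : Fin r → MvPolynomial (Fin n) K}
  {N : ℕ} {G : Set (Fin n →₀ ℕ)}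

theorem monomial_mem_multiplesSpan {a : Fin n →₀ ℕ} (ha : expDeg a = N) (haG : a ∈ G) :
    monomial a (1 : K) ∈ multiplesSpan d f N G :=
  Submodule.subset_span ⟨Sum.inl ⟨a, ha, haG⟩, rfl⟩

theorem monomial_mul_mem_multiplesSpan {ν : Fin n →₀ ℕ} {j : Fin r} (hν : expDeg ν + d j = N)
    (c : K) : monomial ν c * f j ∈ multiplesSpan d f N G := by
  have h : monomial ν (1 : K) * f j ∈ multiplesSpan d f N G :=
    Submodule.subset_span ⟨Sum.inr ⟨j, ν, hν⟩, rfl⟩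
  simpa [← smul_mul_assoc, smul_monomial] using Submodule.smul_mem _ c h

theorem multiplesSpan_le {S : Submodule K (MvPolynomial (Fin n) K)}
    (h₁ : ∀ a, expDeg a = N → a ∈ G → monomial a (1 : K) ∈ S)
    (h₂ : ∀ ν j, expDeg ν + d j = N → monomial ν (1 : K) * f j ∈ S) :
    multiplesSpan d f N G ≤ S := by
  refine Submodule.span_le.mpr ?_
  rintro _ ⟨a | p, rfl⟩
  · exact h₁ a.1 a.2.1 a.2.2
  · exact h₂ p.2.1 p.1 p.2.2

theorem multiplesSpan_le_homogeneousSubmodule (hf : ∀ j, (f j).IsHomogeneous (d j)) :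
    multiplesSpan d f N G ≤ homogeneousSubmodule (Fin n) K N := by
  refine multiplesSpan_le (fun a ha _ => ?_) (fun ν j hν => ?_)
  · rw [← ha]
    exact isHomogeneous_monomial_expDeg a 1
  · rw [← hν]
    exact (isHomogeneous_monomial_expDeg ν 1).mul (hf j)

theorem homogeneousComponent_mem_multiplesSpan (hf : ∀ j, (f j).IsHomogeneous (d j))
    {p : MvPolynomial (Fin n) K} (hp : p ∈ Ideal.span (Set.range f)) :
    homogeneousComponent N p ∈ multiplesSpan d f N G := by
  refine Submodule.span_induction ?_ ?_ ?_ ?_ (p := fun p _ => ∀ g : MvPolynomial (Fin n) K,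
    homogeneousComponent N (g * p) ∈ multiplesSpan d f N G) hp 1 |> fun h => by simpa using h
  · rintro _ ⟨j, rfl⟩ g
    induction g using MvPolynomial.induction_on' with
    | monomial ν c =>
      rw [homogeneousComponent_of_mem ((isHomogeneous_monomial_expDeg ν c).mul (hf j))]
      split_ifs with h
      · exact monomial_mul_mem_multiplesSpan h.symm c
      · exact zero_mem _
    | add p q hp hq =>
      rw [add_mul, map_add]
      exact add_mem hp hq
  · simp
  · intro x y _ _ hx hy g
    rw [mul_add, map_add]
    exact add_mem (hx g) (hy g)
  · intro a x _ hx g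
    rw [smul_eq_mul, ← mul_assoc]
    exact hx _

theorem mem_multiplesSpan_of_mem_span (hf : ∀ j, (f j).IsHomogeneous (d j))
    {p : MvPolynomial (Fin n) K} (hpN : p.IsHomogeneous N) (hp : p ∈ Ideal.span (Set.range f)) :
    p ∈ multiplesSpan d f N G := by
  have := homogeneousComponent_mem_multiplesSpan (N := N) (G := G) hf hp
  rwa [homogeneousComponent_of_mem hpN, if_pos rfl] at this

theorem homogeneousComponent_mem_span (hf : ∀ j, (f j).IsHomogeneous (d j))
    {p : MvPolynomial (Fin n) K} (hp : p ∈ Ideal.span (Set.range f)) (N : ℕ) :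
    homogeneousComponent N p ∈ Ideal.span (Set.range f) := by
  have h : multiplesSpan d f N ∅ ≤ (Ideal.span (Set.range f)).restrictScalars K :=
    multiplesSpan_le (fun a _ ha => ha.elim)
      fun ν j _ => Ideal.mul_mem_left _ _ (Ideal.subset_span ⟨j, rfl⟩)
  exact h (homogeneousComponent_mem_multiplesSpan hf hp)

/-- The coefficients at the exponents of degree `N`. -/
noncomputable def coeffsOfDeg (n : ℕ) (K : Type*) [Field K] (N : ℕ) :
    MvPolynomial (Fin n) K →ₗ[K] ({μ : Fin n →₀ ℕ // expDeg μ = N} → K) :=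
  LinearMap.pi fun μ => lcoeff K μ.1

theorem eq_of_coeffsOfDeg_eq {p q : MvPolynomial (Fin n) K} (hp : p.IsHomogeneous N)
    (hq : q.IsHomogeneous N) (h : coeffsOfDeg n K N p = coeffsOfDeg n K N q) : p = q := by
  ext μ
  by_cases hμ : expDeg μ = N
  · exact congrFun h ⟨μ, hμ⟩
  · rw [hp.coeff_eq_zero hμ, hq.coeff_eq_zero hμ]

theorem span_coeffsOfDeg_eq_top_iff (hf : ∀ j, (f j).IsHomogeneous (d j)) :
    Submodule.span K (Set.range fun k => coeffsOfDeg n K N (multiplesFamily d f N G k)) = ⊤ ↔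
      ∀ μ, expDeg μ = N → monomial μ (1 : K) ∈ multiplesSpan d f N G := by
  classical
  have : Finite {μ : Fin n →₀ ℕ // expDeg μ = N} := Finsupp.finite_of_degree_eq N
  have hcomp : Submodule.span K
      (Set.range fun k => coeffsOfDeg n K N (multiplesFamily d f N G k)) =
      (multiplesSpan d f N G).map (coeffsOfDeg n K N) := by
    rw [multiplesSpan, Submodule.map_span, ← Set.range_comp]
    rfl
  rw [hcomp]
  constructor
  · intro h μ hμ
    have hmem : coeffsOfDeg n K N (monomial μ 1) ∈
        (multiplesSpan d f N G).map (coeffsOfDeg n K N) := h ▸ Submodule.mem_top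
    obtain ⟨p, hp, hpμ⟩ := hmem
    have := eq_of_coeffsOfDeg_eq (multiplesSpan_le_homogeneousSubmodule hf hp)
      (hμ ▸ isHomogeneous_monomial_expDeg μ (1 : K)) hpμ
    rwa [← this]
  · intro h
    rw [eq_top_iff, ← (Pi.basisFun K {μ : Fin n →₀ ℕ // expDeg μ = N}).span_eq,
      Submodule.span_le]
    rintro _ ⟨μ, rfl⟩
    refine ⟨monomial μ.1 1, h μ.1 μ.2, ?_⟩
    ext ν
    simp [coeffsOfDeg, coeff_monomial, Pi.single_apply, Subtype.ext_iff, eq_comm]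

/-- If the monomials in `G` span modulo some forms of degrees `d`, then they span modulo generic
forms of degrees `d`. -/
theorem IsGenericSeq.monomial_mem_multiplesSpan {F : Type*} [Field F] [Algebra F K]
    (hf : IsGenericSeq F d f) {f₀ : Fin r → MvPolynomial (Fin n) K}
    (hf₀ : ∀ j, (f₀ j).IsHomogeneous (d j))
    (h₀ : ∀ μ, expDeg μ = N → monomial μ (1 : K) ∈ multiplesSpan d f₀ N G) :
    ∀ μ, expDeg μ = N → monomial μ (1 : K) ∈ multiplesSpan d f N G := by
  classical
  have : Finite {μ : Fin n →₀ ℕ // expDeg μ = N} := Finsupp.finite_of_degree_eq N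
  rw [← span_coeffsOfDeg_eq_top_iff hf₀] at h₀
  rw [← span_coeffsOfDeg_eq_top_iff hf.1]
  let M : ({a : Fin n →₀ ℕ // expDeg a = N ∧ a ∈ G} ⊕
      (Σ j : Fin r, {ν : Fin n →₀ ℕ // expDeg ν + d j = N})) →
      {μ : Fin n →₀ ℕ // expDeg μ = N} →
      MvPolynomial (Σ i : Fin r, {μ : Fin n →₀ ℕ // expDeg μ = d i}) F :=
    Sum.elim (fun a μ => if a.1 = μ.1 then 1 else 0)
      fun p μ => if h : p.2.1 ≤ μ.1 then X ⟨p.1, μ.1 - p.2.1, by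
        have h1 := expDeg_add (μ.1 - p.2.1) p.2.1
        rw [tsub_add_cancel_of_le h] at h1
        have h2 := p.2.2
        have h3 := μ.2
        omega⟩ else 0
  have hM : ∀ g : Fin r → MvPolynomial (Fin n) K,
      (fun k => coeffsOfDeg n K N (multiplesFamily d g N G k)) = fun k e =>
        aeval (fun p : Σ i : Fin r, {μ : Fin n →₀ ℕ // expDeg μ = d i} =>
          (g p.1).coeff p.2.1) (M k e) := by
    intro g
    funext k e
    rcases k with a | p
    · simp only [coeffsOfDeg, multiplesFamily, M, Sum.elim_inl, LinearMap.pi_apply,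
        lcoeff_apply, coeff_monomial]
      split_ifs <;> simp
    · simp only [coeffsOfDeg, multiplesFamily, M, Sum.elim_inr, LinearMap.pi_apply,
        lcoeff_apply, coeff_monomial_mul']
      split_ifs <;> simp
  rw [hM] at h₀ ⊢
  exact span_eq_top_of_algebraicIndependent M hf.2 _ h₀

end multiplesSpan

/-- Modulo the powers `X j ^ d j`, the monomials in `G` span in degree `N` as soon as `G` contains
those monomials of degree `N` not divisible by any `X j ^ d j`. -/
theorem monomial_mem_multiplesSpan_X_pow {n : ℕ} {K : Type*} [Field K] {d : Fin n → ℕ} {N : ℕ}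
    {G : Set (Fin n →₀ ℕ)} (h : ∀ μ, expDeg μ = N → μ ∈ G ∨ ∃ j, d j ≤ μ j) :
    ∀ μ, expDeg μ = N →
      monomial μ (1 : K) ∈ multiplesSpan d (fun j => (X j : MvPolynomial (Fin n) K) ^ d j) N G := by
  intro μ hμ
  rcases h μ hμ with hG | ⟨j, hj⟩
  · exact monomial_mem_multiplesSpan hμ hG
  · have hle : Finsupp.single j (d j) ≤ μ := by simpa using hj
    obtain ⟨ν, rfl⟩ := exists_add_of_le hle
    rw [expDeg_add, expDeg_single, add_comm] at hμ
    have := monomial_mul_mem_multiplesSpan (K := K) (G := G)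
      (f := fun j => (X j : MvPolynomial (Fin n) K) ^ d j) hμ 1
    rwa [X_pow_eq_monomial, monomial_mul, one_mul, add_comm] at this

theorem mem_restrictSupport_expDeg_iff {n : ℕ} {K : Type*} [Field K] {N : ℕ}
    {p : MvPolynomial (Fin n) K} :
    p ∈ restrictSupport K {μ : Fin n →₀ ℕ | expDeg μ = N} ↔ p.IsHomogeneous N := by
  rw [← mem_homogeneousSubmodule, homogeneousSubmodule_eq_finsupp_supported]
  rfl

theorem isHomogeneous_of_mem_pieces {n : ℕ} {K : Type*} [Field K]
    {x : ℕ → MvPolynomial (Fin n) K} (hx : ∀ i, (x i).IsHomogeneous 1) (m : ℕ) :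
    ∀ k : ℕ, ∀ b ∈ pieces K x m k, b.IsHomogeneous k := by
  induction m with
  | zero =>
    intro k b hb
    by_cases hk : k = 0
    · subst hk
      have hb' : b ∈ Submodule.span K {(1 : MvPolynomial (Fin n) K)} := by simpa [pieces] using hb
      obtain ⟨c, rfl⟩ := Submodule.mem_span_singleton.mp hb'
      rw [smul_eq_C_mul, mul_one]
      exact isHomogeneous_C _ _
    · simp only [pieces, Nat.cast_eq_zero, hk, if_false, Submodule.mem_bot] at hb
      exact hb ▸ isHomogeneous_zero _ _ _
  | succ m ih =>
    intro k
    suffices pieces K x (m + 1) k ≤ homogeneousSubmodule (Fin n) K k from fun b hb => this hb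
    refine iSup_le fun v => Submodule.map_le_iff_le_comap.mpr fun b hb => ?_
    by_cases hv : v ≤ k
    · rw [← Nat.cast_sub hv] at hb
      have := ((hx m).pow v).mul (ih _ b hb)
      rwa [one_mul, Nat.add_sub_cancel' hv] at this
    · rw [pieces_eq_bot x m _ (by omega), Submodule.mem_bot] at hb
      simp [hb]

theorem prod_pow_mem_pieces {K R : Type*} [Field K] [CommRing R] [Algebra K R] (x : ℕ → R)
    (e : ℕ → ℕ) (m : ℕ) :
    ∏ j ∈ Finset.range m, x j ^ e j ∈ pieces K x m (∑ j ∈ Finset.range m, e j : ℕ) := by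
  induction m with
  | zero => simp [pieces]
  | succ m ih =>
    rw [Finset.prod_range_succ, Finset.sum_range_succ, mul_comm]
    exact mul_mem_adjoinPieces ih _ _ (by push_cast; ring)

theorem X_pow_mul_mem_restrictSupport {n : ℕ} {K : Type*} [Field K] {q : MvPolynomial (Fin n) K}
    {k : ℕ} (hq : q.IsHomogeneous k) (l : Fin n) (s : ℕ) :
    X l ^ s * q ∈ restrictSupport K {a : Fin n →₀ ℕ | expDeg a = k + s ∧ s ≤ a l} := by
  rw [← mem_restrictSupport_expDeg_iff, restrictSupport_eq_span] at hq
  induction hq using Submodule.span_induction with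
  | mem p hp =>
    obtain ⟨ν, rfl, rfl⟩ := hp
    rw [X_pow_eq_monomial, monomial_mul, one_mul, monomial_mem_restrictSupport]
    left
    simp [expDeg_add, expDeg_single, add_comm]
  | zero => simp
  | add p q _ _ hp hq => rw [mul_add]; exact add_mem hp hq
  | smul a p _ hp => rw [mul_smul_comm]; exact Submodule.smul_mem _ _ hp

theorem restrictSupport_le_multiplesSpan {n r : ℕ} {K : Type*} [Field K] {d : Fin r → ℕ}
    {f : Fin r → MvPolynomial (Fin n) K} {N : ℕ} {G : Set (Fin n →₀ ℕ)} :
    restrictSupport K {a : Fin n →₀ ℕ | expDeg a = N ∧ a ∈ G} ≤ multiplesSpan d f N G := by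
  rw [restrictSupport_eq_span, Submodule.span_le]
  rintro _ ⟨a, ⟨ha, haG⟩, rfl⟩
  exact monomial_mem_multiplesSpan ha haG

/-- There is a complete intersection of forms of degrees `d` modulo which multiplication by the
`s`-th power of the last variable is surjective in the range predicted by the strong Lefschetz
property. -/
theorem exists_monomial_mem_multiplesSpan {n : ℕ} (hn : 0 < n) {K : Type*} [Field K]
    (d : Fin n → ℕ) {q : K} (hq : Function.Injective fun k : ℕ => q ^ k) {N s : ℕ}
    (hN : ∑ j, ((d j : ℤ) - 1) + s ≤ 2 * N) :
    ∃ f₀ : Fin n → MvPolynomial (Fin n) K, (∀ j, (f₀ j).IsHomogeneous (d j)) ∧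
      ∀ μ, expDeg μ = N → monomial μ (1 : K) ∈
        multiplesSpan d f₀ N {a | s ≤ a ⟨n - 1, Nat.sub_one_lt_of_lt hn⟩} := by
  set x : ℕ → MvPolynomial (Fin n) K := fun i => if h : i < n then X ⟨i, h⟩ else 0 with hxdef
  have hx : ∀ i, (x i).IsHomogeneous 1 := by
    intro i
    simp only [x]
    split_ifs
    · exact isHomogeneous_X _ _
    · exact isHomogeneous_zero _ _ _
  have hprev : ∀ i, (prevVar x i).IsHomogeneous 1 := by
    rintro (_ | i)
    · exact isHomogeneous_zero _ _ _
    · exact hx i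
  have hxj : ∀ j : Fin n, x j = X j := fun j => dif_pos j.2
  let f₀ : Fin n → MvPolynomial (Fin n) K := fun j =>
    ∏ r ∈ Finset.range (d j), (x j - q ^ r • prevVar x j)
  have hf₀ : ∀ j, (f₀ j).IsHomogeneous (d j) := by
    intro j
    have := IsHomogeneous.prod (Finset.range (d j)) (fun r => x j - q ^ r • prevVar x j)
      (fun _ => 1) fun r _ => (hx j).sub ((homogeneousSubmodule _ _ 1).smul_mem _ (hprev j))
    simpa using this
  refine ⟨f₀, hf₀, fun μ hμ => ?_⟩
  let d' : ℕ → ℕ := fun i => if h : i < n then d ⟨i, h⟩ else 0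
  let e : ℕ → ℕ := fun i => if h : i < n then μ ⟨i, h⟩ else 0
  have key := lefschetzSurj_pieces x hq d' n (Ideal.span (Set.range f₀)) fun j hj =>
    Ideal.subset_span ⟨⟨j, hj⟩, by simp [f₀, d', hj]⟩
  have hsum : ∑ j ∈ Finset.range n, ((d' j : ℤ) - 1) = ∑ j, ((d j : ℤ) - 1) := by
    rw [← Fin.sum_univ_eq_sum_range (fun j => (d' j : ℤ) - 1)]
    simp [d']
  have hmem := prod_pow_mem_pieces (K := K) x e n
  rw [← Fin.prod_univ_eq_prod_range (fun j => x j ^ e j), ← Fin.sum_univ_eq_sum_range e] at hmem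
  simp only [hxj, e, Fin.is_lt, dite_true, Fin.eta, ← expDeg_eq_sum, hμ] at hmem
  have hprod : ∏ j, (X j : MvPolynomial (Fin n) K) ^ μ j = monomial μ 1 := by
    rw [monomial_eq, C_1, one_mul, Finsupp.prod_fintype _ _ (by simp)]
  rw [hprod] at hmem
  obtain ⟨c, hc, hcI⟩ := key N s (by rw [hsum]; exact hN) _ hmem
  have hlast : prevVar x n = X ⟨n - 1, Nat.sub_one_lt_of_lt hn⟩ := by
    obtain ⟨m, rfl⟩ := Nat.exists_eq_succ_of_ne_zero hn.ne'
    simp [prevVar, x]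
  rw [hlast] at hcI
  have hmon : (monomial μ (1 : K)).IsHomogeneous N := hμ ▸ isHomogeneous_monomial_expDeg μ 1
  by_cases hs : s ≤ N
  · rw [← Nat.cast_sub hs] at hc
    have hX := X_pow_mul_mem_restrictSupport (isHomogeneous_of_mem_pieces hx n _ c hc)
      ⟨n - 1, Nat.sub_one_lt_of_lt hn⟩ s
    rw [Nat.sub_add_cancel hs] at hX
    have hle := restrictSupport_le_multiplesSpan (d := d) (f := f₀)
      (G := {a | s ≤ a ⟨n - 1, Nat.sub_one_lt_of_lt hn⟩}) hX
    have := mem_multiplesSpan_of_mem_span (G := {a | s ≤ a ⟨n - 1, Nat.sub_one_lt_of_lt hn⟩}) hf₀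
      (hmon.sub (multiplesSpan_le_homogeneousSubmodule hf₀ hle)) hcI
    simpa using add_mem this hle
  · rw [pieces_eq_bot x n _ (by omega), Submodule.mem_bot] at hc
    rw [hc, mul_zero, sub_zero] at hcI
    exact mem_multiplesSpan_of_mem_span hf₀ hmon hcI

theorem finite_setOf_expDeg_eq (n N : ℕ) (G : Set (Fin n →₀ ℕ)) :
    {a : Fin n →₀ ℕ | expDeg a = N ∧ a ∈ G}.Finite :=
  (Finsupp.finite_of_degree_eq (σ := Fin n) N).subset fun _ ha => ha.1

instance finiteDimensional_restrictSupport {n N : ℕ} {K : Type*} [Field K]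
    {G : Set (Fin n →₀ ℕ)} :
    FiniteDimensional K (restrictSupport K {a : Fin n →₀ ℕ | expDeg a = N ∧ a ∈ G}) := by
  have := (finite_setOf_expDeg_eq n N G).to_subtype
  exact Module.Finite.of_basis (basisRestrictSupport K _)

section redMap

variable {n : ℕ} {K : Type*} [Field K]

/-- The linear map replacing every full power `X j ^ d j` in a monomial by `f j`. -/
noncomputable def redMap (d : Fin n → ℕ) (f : Fin n → MvPolynomial (Fin n) K) :
    MvPolynomial (Fin n) K →ₗ[K] MvPolynomial (Fin n) K :=
  (basisMonomials (Fin n) K).constr K fun μ => ∏ j, (X j ^ (μ j % d j) * f j ^ (μ j / d j))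

variable {d : Fin n → ℕ} {f : Fin n → MvPolynomial (Fin n) K}

theorem redMap_monomial (μ : Fin n →₀ ℕ) :
    redMap d f (monomial μ 1) = ∏ j, (X j ^ (μ j % d j) * f j ^ (μ j / d j)) := by
  rw [redMap, ← Module.Basis.constr_basis (basisMonomials (Fin n) K) K
    (fun μ => ∏ j, (X j ^ (μ j % d j) * f j ^ (μ j / d j))) μ, coe_basisMonomials]

theorem redMap_monomial_of_lt {μ : Fin n →₀ ℕ} (hμ : ∀ j, μ j < d j) :
    redMap d f (monomial μ 1) = monomial μ 1 := by
  rw [redMap_monomial, monomial_eq, C_1, one_mul, Finsupp.prod_fintype _ _ (by simp)]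
  exact Finset.prod_congr rfl fun j _ => by
    rw [Nat.mod_eq_of_lt (hμ j), Nat.div_eq_of_lt (hμ j), pow_zero, mul_one]

theorem redMap_X_pow_mul (hd : ∀ j, 1 ≤ d j) (j : Fin n) (p : MvPolynomial (Fin n) K) :
    redMap d f (X j ^ d j * p) = f j * redMap d f p := by
  suffices (redMap d f).comp (LinearMap.mulLeft K (X j ^ d j)) =
      (LinearMap.mulLeft K (f j)).comp (redMap d f) from LinearMap.congr_fun this p
  refine (basisMonomials (Fin n) K).ext fun μ => ?_
  simp only [coe_basisMonomials, LinearMap.comp_apply, LinearMap.mulLeft_apply]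
  rw [X_pow_eq_monomial, monomial_mul, one_mul, redMap_monomial, redMap_monomial,
    ← Finset.mul_prod_erase _ _ (Finset.mem_univ j),
    ← Finset.mul_prod_erase Finset.univ _ (Finset.mem_univ j), ← mul_assoc]
  congr 1
  · simp only [Finsupp.add_apply, Finsupp.single_eq_same, Nat.add_mod_left,
      Nat.add_div_left _ (hd j), pow_succ]
    ring
  · refine Finset.prod_congr rfl fun i hi => ?_
    rw [Finsupp.add_apply, Finsupp.single_eq_of_ne (Finset.ne_of_mem_erase hi), zero_add]

theorem isHomogeneous_redMap (hf : ∀ j, (f j).IsHomogeneous (d j)) {N : ℕ}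
    {p : MvPolynomial (Fin n) K} (hp : p.IsHomogeneous N) : (redMap d f p).IsHomogeneous N := by
  rw [← mem_restrictSupport_expDeg_iff, restrictSupport_eq_span] at hp
  rw [← mem_homogeneousSubmodule, ← Submodule.mem_comap]
  refine Submodule.span_le.mpr ?_ hp
  rintro _ ⟨μ, rfl, rfl⟩
  simp only [Submodule.comap_coe, Set.mem_preimage, SetLike.mem_coe, redMap_monomial,
    mem_homogeneousSubmodule]
  rw [expDeg_eq_sum]
  refine IsHomogeneous.prod _ _ _ fun j _ => ?_
  have := ((isHomogeneous_X K j).pow (μ j % d j)).mul ((hf j).pow (μ j / d j))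
  rwa [one_mul, Nat.mod_add_div] at this

theorem monomial_mem_map_redMap {N : ℕ} (hd : ∀ j, 1 ≤ d j)
    (hspan : ∀ N μ, expDeg μ = N →
      monomial μ (1 : K) ∈ multiplesSpan d f N {a | ∀ j, a j < d j}) :
    ∀ μ, expDeg μ = N → monomial μ (1 : K) ∈ (homogeneousSubmodule (Fin n) K N).map (redMap d f) := by
  induction N using Nat.strong_induction_on with
  | _ N ih =>
    intro μ hμ
    refine multiplesSpan_le (fun a ha haG => ?_) (fun ν j hν => ?_) (hspan N μ hμ)
    · exact ⟨monomial a 1, ha ▸ isHomogeneous_monomial_expDeg a 1, redMap_monomial_of_lt haG⟩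
    · obtain ⟨g, hg, hgν⟩ := ih (expDeg ν) (by have := hd j; omega) ν rfl
      refine ⟨X j ^ d j * g, ?_, ?_⟩
      · have := ((isHomogeneous_X K j).pow (d j)).mul hg
        rwa [one_mul, add_comm, hν] at this
      · rw [redMap_X_pow_mul hd, hgν, mul_comm]

theorem redMap_injOn {N : ℕ} (hd : ∀ j, 1 ≤ d j) (hf : ∀ j, (f j).IsHomogeneous (d j))
    (hspan : ∀ N μ, expDeg μ = N →
      monomial μ (1 : K) ∈ multiplesSpan d f N {a | ∀ j, a j < d j})
    {p q : MvPolynomial (Fin n) K} (hp : p.IsHomogeneous N) (hq : q.IsHomogeneous N)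
    (h : redMap d f p = redMap d f q) : p = q := by
  let H := homogeneousSubmodule (Fin n) K N
  have hH : restrictSupport K {a : Fin n →₀ ℕ | expDeg a = N ∧ a ∈ Set.univ} = H := by
    ext p
    simp only [Set.mem_univ, and_true, mem_restrictSupport_expDeg_iff]
    rfl
  have : FiniteDimensional K H := hH ▸ inferInstance
  let T : H →ₗ[K] H := (redMap d f).restrict fun p hp => isHomogeneous_redMap hf hp
  have hT : Function.Surjective T := by
    have hle : H ≤ H.map (redMap d f) := by
      refine hH.ge.trans ?_
      rw [restrictSupport_eq_span, Submodule.span_le]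
      rintro _ ⟨μ, ⟨hμ, -⟩, rfl⟩
      exact monomial_mem_map_redMap hd hspan μ hμ
    intro b
    obtain ⟨a, ha, hab⟩ := hle b.2
    exact ⟨⟨a, ha⟩, Subtype.ext hab⟩
  have := LinearMap.injective_iff_surjective.mpr hT
    (a₁ := ⟨p, hp⟩) (a₂ := ⟨q, hq⟩) (Subtype.ext h)
  exact congrArg Subtype.val this

/-- The monomials not divisible by any `X j ^ d j` are linearly independent modulo the ideal of a
complete intersection for which they span. -/
theorem eq_zero_of_mem_span {N : ℕ} (hd : ∀ j, 1 ≤ d j) (hf : ∀ j, (f j).IsHomogeneous (d j))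
    (hspan : ∀ N μ, expDeg μ = N →
      monomial μ (1 : K) ∈ multiplesSpan d f N {a | ∀ j, a j < d j})
    {p : MvPolynomial (Fin n) K}
    (hp : p ∈ restrictSupport K {a : Fin n →₀ ℕ | expDeg a = N ∧ a ∈ {a | ∀ j, a j < d j}})
    (hpJ : p ∈ Ideal.span (Set.range f)) : p = 0 := by
  have hpN : p.IsHomogeneous N :=
    mem_restrictSupport_expDeg_iff.mp (restrictSupport_mono K (fun a ha => ha.1) hp)
  have hred : redMap d f p = p := by
    rw [restrictSupport_eq_span] at hp
    have : Set.EqOn (redMap d f) (LinearMap.id : MvPolynomial (Fin n) K →ₗ[K] _) ((monomial · (1 : K)) ''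
        {a : Fin n →₀ ℕ | expDeg a = N ∧ a ∈ {a | ∀ j, a j < d j}}) := by
      rintro _ ⟨a, ⟨-, ha⟩, rfl⟩
      exact redMap_monomial_of_lt ha
    exact LinearMap.eqOn_span this hp
  let M : Ideal (MvPolynomial (Fin n) K) :=
    Ideal.span ((fun s => monomial s (1 : K)) '' Set.range fun j => Finsupp.single j (d j))
  obtain ⟨g, ⟨hgN, hgM⟩, hgp⟩ : p ∈
      (homogeneousSubmodule (Fin n) K N ⊓ M.restrictScalars K).map (redMap d f) := by
    refine multiplesSpan_le (fun a _ ha => ha.elim) (fun ν j hν => ?_)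
      (mem_multiplesSpan_of_mem_span (G := ∅) hf hpN hpJ)
    obtain ⟨g, hg, hgν⟩ := monomial_mem_map_redMap hd hspan ν rfl
    refine ⟨X j ^ d j * g, ⟨?_, ?_⟩, ?_⟩
    · have := ((isHomogeneous_X K j).pow (d j)).mul hg
      rwa [one_mul, add_comm, hν] at this
    · refine M.mul_mem_right _ (Ideal.subset_span ⟨_, ⟨j, rfl⟩, ?_⟩)
      rw [X_pow_eq_monomial]
    · rw [redMap_X_pow_mul hd, hgν, mul_comm]
  rw [redMap_injOn hd hf hspan hgN hpN (hgp.trans hred.symm)] at hgM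
  by_contra hne
  obtain ⟨a, ha⟩ := support_nonempty.mpr hne
  obtain ⟨_, ⟨j, rfl⟩, hj⟩ := mem_ideal_span_monomial_image.mp hgM a ha
  have h1 := (hp ha).2 j
  have h2 : d j ≤ a j := by simpa using hj j
  omega

end redMap

section lefschetz

variable {n : ℕ} {K : Type*} [Field K] {d : Fin n → ℕ} {f : Fin n → MvPolynomial (Fin n) K}

theorem exists_sub_mem_span {N : ℕ} {G : Set (Fin n →₀ ℕ)} {p : MvPolynomial (Fin n) K}
    (hp : p.IsHomogeneous N)
    (hspan : ∀ μ, expDeg μ = N → monomial μ (1 : K) ∈ multiplesSpan d f N G) :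
    ∃ q ∈ restrictSupport K {a : Fin n →₀ ℕ | expDeg a = N ∧ a ∈ G},
      p - q ∈ Ideal.span (Set.range f) := by
  have hle : restrictSupport K {μ : Fin n →₀ ℕ | expDeg μ = N} ≤
      restrictSupport K {a : Fin n →₀ ℕ | expDeg a = N ∧ a ∈ G} ⊔
        (Ideal.span (Set.range f)).restrictScalars K := by
    rw [restrictSupport_eq_span, Submodule.span_le]
    rintro _ ⟨μ, hμ, rfl⟩
    refine multiplesSpan_le (fun a ha haG => Submodule.mem_sup_left ?_)
      (fun ν j _ => Submodule.mem_sup_right ?_) (hspan μ hμ)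
    · rw [monomial_mem_restrictSupport]
      exact Or.inl ⟨ha, haG⟩
    · exact Ideal.mul_mem_left _ _ (Ideal.subset_span ⟨j, rfl⟩)
  obtain ⟨q, hq, r, hr, rfl⟩ := Submodule.mem_sup.mp
    (hle (mem_restrictSupport_expDeg_iff.mpr hp))
  exact ⟨q, hq, by simpa using hr⟩

theorem exists_X_pow_mul_eq {k s : ℕ} {l : Fin n} {p : MvPolynomial (Fin n) K}
    (hp : p ∈ restrictSupport K {a : Fin n →₀ ℕ | expDeg a = k + s ∧ s ≤ a l}) :
    ∃ q : MvPolynomial (Fin n) K, q.IsHomogeneous k ∧ X l ^ s * q = p := by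
  suffices restrictSupport K {a : Fin n →₀ ℕ | expDeg a = k + s ∧ s ≤ a l} ≤
      (homogeneousSubmodule (Fin n) K k).map (LinearMap.mulLeft K (X l ^ s)) from this hp
  rw [restrictSupport_eq_span, Submodule.span_le]
  rintro _ ⟨a, ⟨ha, hs⟩, rfl⟩
  obtain ⟨b, rfl⟩ := exists_add_of_le (Finsupp.single_le_iff.mpr hs)
  rw [expDeg_add, expDeg_single, add_comm, Nat.add_right_cancel_iff] at ha
  exact ⟨monomial b 1, ha ▸ isHomogeneous_monomial_expDeg b 1, by
    simp [X_pow_eq_monomial, monomial_mul]⟩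

theorem injective_of_range_le_range {V V' W : Type*} [AddCommGroup V] [Module K V]
    [AddCommGroup V'] [Module K V'] [AddCommGroup W] [Module K W] [FiniteDimensional K V]
    [FiniteDimensional K V'] {T : V' →ₗ[K] W} {S : V →ₗ[K] W} (hT : Function.Injective T)
    (h : LinearMap.range T ≤ LinearMap.range S)
    (hdim : Module.finrank K V ≤ Module.finrank K V') : Function.Injective S := by
  have h1 := Submodule.finrank_mono h
  have h2 := S.finrank_range_add_finrank_ker
  rw [LinearMap.finrank_range_of_inj hT] at h1
  rw [← LinearMap.ker_eq_bot, ← Submodule.finrank_eq_zero (R := K)]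
  omega

/-- Symmetry of the Hilbert function of a monomial complete intersection. -/
theorem finrank_restrictSupport_eq (hd : ∀ j, 1 ≤ d j) {N M : ℕ}
    (h : N + M = ∑ j, (d j - 1)) :
    Module.finrank K (restrictSupport K
        {a : Fin n →₀ ℕ | expDeg a = N ∧ a ∈ {a | ∀ j, a j < d j}}) =
      Module.finrank K (restrictSupport K
        {a : Fin n →₀ ℕ | expDeg a = M ∧ a ∈ {a | ∀ j, a j < d j}}) := by
  rw [Module.finrank_eq_nat_card_basis (basisRestrictSupport K _),
    Module.finrank_eq_nat_card_basis (basisRestrictSupport K _)]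
  let c : Fin n →₀ ℕ := Finsupp.equivFunOnFinite.symm fun j => d j - 1
  have hc : expDeg c = N + M := by rw [h, expDeg_eq_sum]; rfl
  have hle : ∀ a : Fin n →₀ ℕ, (∀ j, a j < d j) → a ≤ c := fun a ha j => Nat.le_sub_one_of_lt (ha j)
  have hdeg : ∀ a : Fin n →₀ ℕ, (∀ j, a j < d j) → expDeg (c - a) + expDeg a = N + M := by
    intro a ha
    rw [← expDeg_add, tsub_add_cancel_of_le (hle a ha), hc]
  have hlt : ∀ a : Fin n →₀ ℕ, ∀ j, (c - a) j < d j := fun a j =>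
    (Nat.sub_le _ _).trans_lt (Nat.sub_one_lt_of_lt (hd j))
  refine Nat.card_congr ⟨fun a => ⟨c - a.1, ?_, hlt a.1⟩, fun a => ⟨c - a.1, ?_, hlt a.1⟩, ?_, ?_⟩
  · have := hdeg a.1 a.2.2
    have := a.2.1
    omega
  · have := hdeg a.1 a.2.2
    have := a.2.1
    omega
  · exact fun a => Subtype.ext (tsub_tsub_cancel_of_le (hle a.1 a.2.2))
  · exact fun a => Subtype.ext (tsub_tsub_cancel_of_le (hle a.1 a.2.2))

/-- By symmetry of the Hilbert function, surjectivity of multiplication by `X l ^ s` from degree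
`k` to the complementary degree `k + s` implies injectivity. -/
theorem mem_span_of_X_pow_mul_mem (hd : ∀ j, 1 ≤ d j) (hf : ∀ j, (f j).IsHomogeneous (d j))
    (hspan : ∀ N μ, expDeg μ = N →
      monomial μ (1 : K) ∈ multiplesSpan d f N {a | ∀ j, a j < d j})
    {k s : ℕ} {l : Fin n} (hks : k + (k + s) = ∑ j, (d j - 1))
    (hsurj : ∀ μ, expDeg μ = k + s → monomial μ (1 : K) ∈ multiplesSpan d f (k + s) {a | s ≤ a l})
    {p : MvPolynomial (Fin n) K} (hp : p.IsHomogeneous k)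
    (hpJ : X l ^ s * p ∈ Ideal.span (Set.range f)) : p ∈ Ideal.span (Set.range f) := by
  set J := Ideal.span (Set.range f) with hJ
  let V : ℕ → Submodule K (MvPolynomial (Fin n) K) := fun N =>
    restrictSupport K {a : Fin n →₀ ℕ | expDeg a = N ∧ a ∈ {a | ∀ j, a j < d j}}
  have hV : ∀ N, V N ≤ homogeneousSubmodule (Fin n) K N := fun N q hq =>
    mem_restrictSupport_expDeg_iff.mp (restrictSupport_mono K (fun a ha => ha.1) hq)
  let π : MvPolynomial (Fin n) K →ₗ[K] MvPolynomial (Fin n) K ⧸ J :=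
    (Ideal.Quotient.mkₐ K J).toLinearMap
  have hπ : ∀ p q, π p = π q ↔ p - q ∈ J := fun p q => Ideal.Quotient.mk_eq_mk_iff_sub_mem p q
  let T : V (k + s) →ₗ[K] MvPolynomial (Fin n) K ⧸ J := π ∘ₗ (V (k + s)).subtype
  let S : V k →ₗ[K] MvPolynomial (Fin n) K ⧸ J :=
    π ∘ₗ LinearMap.mulLeft K (X l ^ s) ∘ₗ (V k).subtype
  have hT : Function.Injective T := fun a b hab => Subtype.ext <| sub_eq_zero.mp <|
    eq_zero_of_mem_span hd hf hspan (sub_mem a.2 b.2) ((hπ _ _).mp hab)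
  have hTS : LinearMap.range T ≤ LinearMap.range S := by
    rintro _ ⟨a, rfl⟩
    obtain ⟨b, hb, hab⟩ := exists_sub_mem_span (hV _ a.2) hsurj
    obtain ⟨c, hc, rfl⟩ := exists_X_pow_mul_eq hb
    obtain ⟨e, he, hce⟩ := exists_sub_mem_span hc (hspan k)
    refine ⟨⟨e, he⟩, (hπ _ _).mpr ?_⟩
    have := neg_mem (add_mem hab (J.mul_mem_left (X l ^ s) hce))
    convert this using 1
    simp only [LinearMap.comp_apply, Submodule.subtype_apply, LinearMap.mulLeft_apply]
    ring
  have hS := injective_of_range_le_range hT hTS (finrank_restrictSupport_eq hd hks).le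
  obtain ⟨e, he, hpe⟩ := exists_sub_mem_span hp (hspan k)
  have he0 : (⟨e, he⟩ : V k) = 0 := by
    refine hS ((hπ _ _).mpr ?_)
    have := sub_mem hpJ (J.mul_mem_left (X l ^ s) hpe)
    convert this using 1
    simp
    ring
  rw [show e = 0 from congrArg Subtype.val he0, sub_zero] at hpe
  exact hpe

end lefschetz

section initialIdeal

variable {n : ℕ}

theorem drlLT_add_left_iff {a b : Fin n →₀ ℕ} (c : Fin n →₀ ℕ) :
    DrlLT (c + a) (c + b) ↔ DrlLT a b := by
  simp [DrlLT, expDeg_add]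

variable {K : Type*} [Field K]

theorem isLeadExp_monomial_mul_iff {p : MvPolynomial (Fin n) K} {μ : Fin n →₀ ℕ}
    (ρ : Fin n →₀ ℕ) : IsLeadExp (monomial ρ 1 * p) (ρ + μ) ↔ IsLeadExp p μ := by
  classical
  simp only [IsLeadExp, mem_support_iff, coeff_monomial_mul, one_mul]
  refine and_congr_right fun _ => ⟨fun h ν hν hne => ?_, fun h ν hν hne => ?_⟩
  · refine (drlLT_add_left_iff ρ).mp (h (ρ + ν) ?_ fun h' => hne (add_left_cancel h'))
    rwa [coeff_monomial_mul, one_mul]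
  · rw [coeff_monomial_mul'] at hν
    split_ifs at hν with hle
    · obtain ⟨ν, rfl⟩ := exists_add_of_le hle
      rw [add_tsub_cancel_left, one_mul] at hν
      exact (drlLT_add_left_iff ρ).mpr (h ν hν fun h' => hne (h' ▸ rfl))
    · exact absurd rfl hν

theorem monomial_mem_initialIdeal_iff {I : Ideal (MvPolynomial (Fin n) K)} {μ : Fin n →₀ ℕ} :
    monomial μ (1 : K) ∈ initialIdeal I ↔ ∃ p ∈ I, IsLeadExp p μ := by
  have hI : initialIdeal I = Ideal.span ((fun s => monomial s (1 : K)) ''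
      {μ | ∃ p ∈ I, p ≠ 0 ∧ IsLeadExp p μ}) := by
    rw [initialIdeal]
    congr 1
    ext m
    constructor
    · rintro ⟨p, hp, hp0, μ, hμ, rfl⟩
      exact ⟨μ, ⟨p, hp, hp0, hμ⟩, rfl⟩
    · rintro ⟨μ, ⟨p, hp, hp0, hμ⟩, rfl⟩
      exact ⟨p, hp, hp0, μ, hμ, rfl⟩
  rw [hI, mem_ideal_span_monomial_image]
  constructor
  · intro h
    obtain ⟨μ', ⟨p, hp, -, hlead⟩, hle⟩ := h μ (by simp [mem_support_iff])
    obtain ⟨ρ, rfl⟩ := exists_add_of_le hle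
    refine ⟨monomial ρ 1 * p, I.mul_mem_left _ hp, ?_⟩
    rw [add_comm]
    exact (isLeadExp_monomial_mul_iff ρ).mpr hlead
  · rintro ⟨p, hp, hlead⟩ ν hν
    rw [Finset.mem_singleton.mp (support_monomial_subset hν)]
    exact ⟨μ, ⟨p, hp, support_nonempty.mp ⟨μ, hlead.1⟩, hlead⟩, le_rfl⟩

theorem drlLT_of_lt_last {a b : Fin n →₀ ℕ} {l : Fin n} (hl : ∀ j, j ≤ l)
    (hab : expDeg a = expDeg b) (h : b l < a l) : DrlLT a b :=
  Or.inr ⟨hab, l, h, fun j hj => absurd (hl j) hj.not_ge⟩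

theorem DrlLT.last_le {a b : Fin n →₀ ℕ} {l : Fin n} (hl : ∀ j, j ≤ l)
    (hab : expDeg a = expDeg b) (h : DrlLT a b) : b l ≤ a l := by
  rcases h with h | ⟨-, t, ht, heq⟩
  · omega
  · rcases (hl t).eq_or_lt with rfl | hlt
    · exact ht.le
    · exact (heq l hlt).ge

variable {d : Fin n → ℕ} {f : Fin n → MvPolynomial (Fin n) K}

theorem last_le_of_mem_stdMon {l : Fin n} (hl : ∀ j, j ≤ l) {N s : ℕ}
    (hsurj : ∀ μ, expDeg μ = N → monomial μ (1 : K) ∈ multiplesSpan d f N {a | s ≤ a l})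
    {μ : Fin n →₀ ℕ} (hμ : μ ∈ stdMon (Ideal.span (Set.range f)) N) : s ≤ μ l := by
  by_contra! hlt
  obtain ⟨hdeg, hmem⟩ := hμ
  obtain ⟨q, hq, hqJ⟩ := exists_sub_mem_span
    (hdeg ▸ isHomogeneous_monomial_expDeg μ (1 : K)) hsurj
  refine hmem (monomial_mem_initialIdeal_iff.mpr ⟨_, hqJ, ?_, fun ν hν hne => ?_⟩)
  · have : μ ∉ q.support := fun h => hlt.not_ge (hq h).2
    simp only [mem_support_iff, not_not] at this
    simp [mem_support_iff, this]
  · classical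
    have hνq : ν ∈ q.support := by
      rw [mem_support_iff, coeff_sub, coeff_monomial, if_neg hne.symm, zero_sub, neg_ne_zero] at hν
      exact mem_support_iff.mpr hν
    exact drlLT_of_lt_last hl ((hq hνq).1.trans hdeg.symm) (hlt.trans_le (hq hνq).2)

theorem monomial_mem_initialIdeal_of_add {l : Fin n} (hl : ∀ j, j ≤ l)
    (hf : ∀ j, (f j).IsHomogeneous (d j)) {k s : ℕ}
    (hinj : ∀ p : MvPolynomial (Fin n) K, p.IsHomogeneous k →
      X l ^ s * p ∈ Ideal.span (Set.range f) → p ∈ Ideal.span (Set.range f))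
    {ν : Fin n →₀ ℕ} (hν : expDeg ν = k)
    (h : monomial (ν + Finsupp.single l s) (1 : K) ∈ initialIdeal (Ideal.span (Set.range f))) :
    monomial ν (1 : K) ∈ initialIdeal (Ideal.span (Set.range f)) := by
  classical
  obtain ⟨p, hp, hpsupp, hlead⟩ := monomial_mem_initialIdeal_iff.mp h
  have hdeg : expDeg (ν + Finsupp.single l s) = k + s := by
    rw [expDeg_add, expDeg_single, hν]
  set p' := homogeneousComponent (k + s) p with hp'
  have hcoeff : ∀ a, a ∈ p'.support ↔ expDeg a = k + s ∧ a ∈ p.support := by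
    intro a
    rw [mem_support_iff, hp', coeff_homogeneousComponent, ← expDeg_eq_degree, mem_support_iff]
    simp
  have hp's : p' ∈ restrictSupport K {a : Fin n →₀ ℕ | expDeg a = k + s ∧ s ≤ a l} := by
    intro a ha
    obtain ⟨had, hap⟩ := (hcoeff a).mp ha
    refine ⟨had, ?_⟩
    have hs : s ≤ (ν + Finsupp.single l s) l := by simp
    by_cases hne : a = ν + Finsupp.single l s
    · rwa [hne]
    · exact hs.trans ((hlead a hap hne).last_le hl (had.trans hdeg.symm))
  obtain ⟨q, hq, hqp⟩ := exists_X_pow_mul_eq hp's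
  have hqJ := hinj q hq (hqp ▸ homogeneousComponent_mem_span hf hp _)
  refine monomial_mem_initialIdeal_iff.mpr ⟨q, hqJ, ?_⟩
  rw [← isLeadExp_monomial_mul_iff (Finsupp.single l s), ← X_pow_eq_monomial, hqp, add_comm]
  exact ⟨(hcoeff _).mpr ⟨hdeg, hpsupp⟩, fun a ha => hlead a ((hcoeff a).mp ha).2⟩

end initialIdeal

/-- The powers of a coefficient of a generic form are distinct. -/
theorem IsGenericSeq.exists_pow_injective {F K : Type*} [Field F] [Field K] [Algebra F K]
    {n r : ℕ} {d : Fin r → ℕ} {f : Fin r → MvPolynomial (Fin n) K} (hf : IsGenericSeq F d f)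
    (hn : 0 < n) (j : Fin r) : ∃ q : K, Function.Injective fun k : ℕ => q ^ k := by
  have h := transcendental_iff_injective.mp
    (hf.2.transcendental ⟨j, Finsupp.single ⟨0, hn⟩ (d j), expDeg_single _ _⟩)
  refine ⟨(f j).coeff (Finsupp.single ⟨0, hn⟩ (d j)), fun a b hab => ?_⟩
  have := @h (Polynomial.X ^ a) (Polynomial.X ^ b) (by simpa using hab)
  simpa using congrArg Polynomial.natDegree this

theorem sum_pred_eq {n : ℕ} {d : Fin n → ℕ} (hd : ∀ i, 1 ≤ d i) :
    (∑ j, d j) - n = ∑ j, (d j - 1) := by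
  rw [Finset.sum_tsub_distrib _ fun j _ => hd j]
  simp

theorem filter_lt_pred_eq_erase {n : ℕ} (hn : 0 < n) :
    (Finset.univ.filter fun j : Fin n => (j : ℕ) < n - 1) =
      Finset.univ.erase ⟨n - 1, Nat.sub_one_lt_of_lt hn⟩ := by
  ext j
  simp only [Finset.mem_filter, Finset.mem_univ, true_and, Finset.mem_erase, and_true, Fin.ext_iff,
    ne_eq]
  omega

theorem IsGenericSeq.monomial_mem_multiplesSpan_last {F K : Type*} [Field F] [Field K]
    [Algebra F K] {n : ℕ} (hn : 0 < n) {d : Fin n → ℕ} (hd : ∀ i, 1 ≤ d i)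
    {f : Fin n → MvPolynomial (Fin n) K} (hf : IsGenericSeq F d f) {δ δs σ : ℕ}
    (hδ : δ = (∑ j, d j) - n)
    (hδs : δs = (∑ j ∈ Finset.univ.filter (fun j : Fin n => (j : ℕ) < n - 1), d j) - (n - 1))
    (hσ : σ = min δs (δ / 2)) {i : ℕ} (hi : i ≤ δ - 2 * σ) :
    ∀ μ, expDeg μ = σ + i → monomial μ (1 : K) ∈
      multiplesSpan d f (σ + i) {a | i ≤ a ⟨n - 1, Nat.sub_one_lt_of_lt hn⟩} := by
  set l : Fin n := ⟨n - 1, Nat.sub_one_lt_of_lt hn⟩ with hl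
  rw [sum_pred_eq hd] at hδ
  rcases min_choice δs (δ / 2) with h | h
  · rw [h] at hσ
    refine hf.monomial_mem_multiplesSpan (fun j => isHomogeneous_X_pow j (d j))
      (monomial_mem_multiplesSpan_X_pow fun μ hμ => ?_)
    by_contra! hcon
    obtain ⟨hlt, hμd⟩ := hcon
    rw [filter_lt_pred_eq_erase hn] at hδs
    have hδs' : δs = ∑ j ∈ Finset.univ.erase l, (d j - 1) := by
      rw [hδs, Finset.sum_tsub_distrib _ fun j _ => hd j]
      simp [hl]
    have hle : ∑ j ∈ Finset.univ.erase l, μ j ≤ δs :=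
      hδs' ▸ Finset.sum_le_sum fun j _ => Nat.le_sub_one_of_lt (hμd j)
    rw [expDeg_eq_sum, ← Finset.add_sum_erase _ _ (Finset.mem_univ l)] at hμ
    replace hlt : μ l < i := not_le.mp hlt
    omega
  · rw [h] at hσ
    by_cases hi0 : i = 0
    · subst hi0
      exact fun μ hμ => _root_.monomial_mem_multiplesSpan hμ (Nat.zero_le _)
    · obtain ⟨q, hq⟩ := hf.exists_pow_injective hn l
      have hcast : ∑ j, ((d j : ℤ) - 1) = δ := by
        rw [hδ, Nat.cast_sum]
        exact Finset.sum_congr rfl fun j _ => by rw [Nat.cast_sub (hd j), Nat.cast_one]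
      obtain ⟨f₀, hf₀, h₀⟩ := exists_monomial_mem_multiplesSpan hn d hq (N := σ + i) (s := i)
        (by rw [hcast]; push_cast; omega)
      exact hf.monomial_mem_multiplesSpan hf₀ h₀

/-- for `0 ≤ i ≤ δ − 2σ`, `B_{σ+i} = x_n^i·B_σ`. -/
theorem stmt2 {F K : Type*} [Field F] [Field K] [Algebra F K] [Infinite K]
    {n : ℕ} (hn : 0 < n) (d : Fin n → ℕ) (hd : ∀ i, 1 ≤ d i)
    (f : Fin n → MvPolynomial (Fin n) K) (hf : IsGenericSeq F d f)
    (J : Ideal (MvPolynomial (Fin n) K)) (hJ : J = Ideal.span (Set.range f))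
    (δ δs σ : ℕ) (hδ : δ = (∑ j, d j) - n)
    (hδs : δs = (∑ j ∈ Finset.univ.filter (fun j : Fin n => (j : ℕ) < n - 1), d j) - (n - 1))
    (hσ : σ = min δs (δ / 2))
    (i : ℕ) (hi : i ≤ δ - 2 * σ) :
    stdMon J (σ + i) =
      (fun ν => ν + Finsupp.single (⟨n - 1, by omega⟩ : Fin n) i) '' stdMon J σ := by
  subst hJ
  set l : Fin n := ⟨n - 1, by omega⟩ with hldef
  have hl : ∀ j, j ≤ l := fun j => Nat.le_sub_one_of_lt j.2
  have hsurj : ∀ s ≤ δ - 2 * σ, ∀ μ, expDeg μ = σ + s → monomial μ (1 : K) ∈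
      multiplesSpan d f (σ + s) {a | s ≤ a l} := fun s hs =>
    hf.monomial_mem_multiplesSpan_last hn hd hδ hδs hσ hs
  have hspan : ∀ N μ, expDeg μ = N →
      monomial μ (1 : K) ∈ multiplesSpan d f N {a | ∀ j, a j < d j} := fun N =>
    hf.monomial_mem_multiplesSpan (fun j => isHomogeneous_X_pow j (d j))
      (monomial_mem_multiplesSpan_X_pow fun μ _ => by
        by_contra! hcon
        obtain ⟨j, hj⟩ := not_forall.mp hcon.1
        exact hj (hcon.2 j))
  have hinj : ∀ p : MvPolynomial (Fin n) K, p.IsHomogeneous σ →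
      X l ^ i * p ∈ Ideal.span (Set.range f) → p ∈ Ideal.span (Set.range f) := by
    intro p hp hpJ
    rw [sum_pred_eq hd] at hδ
    refine mem_span_of_X_pow_mul_mem hd hf.1 hspan (by omega) (hsurj _ le_rfl) hp ?_
    rw [← Nat.sub_add_cancel hi, pow_add, mul_assoc]
    exact Ideal.mul_mem_left _ _ hpJ
  ext μ
  constructor
  · intro hμ
    obtain ⟨ν, rfl⟩ := exists_add_of_le
      (Finsupp.single_le_iff.mpr (last_le_of_mem_stdMon hl (hsurj i hi) hμ))
    obtain ⟨hdeg, hmem⟩ := hμ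
    rw [expDeg_add, expDeg_single] at hdeg
    refine ⟨ν, ⟨by omega, fun hν => hmem ?_⟩, add_comm _ _⟩
    have := Ideal.mul_mem_left _ (monomial (Finsupp.single l i) (1 : K)) hν
    rwa [monomial_mul, one_mul] at this
  · rintro ⟨ν, ⟨hdeg, hmem⟩, rfl⟩
    refine ⟨by rw [expDeg_add, expDeg_single, hdeg], fun h => hmem ?_⟩
    exact monomial_mem_initialIdeal_of_add hl hf.1 hinj hdeg h
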